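/- For every d ≥ 2, the ball B(0,1) = {x ∈ ℤ^d : ‖x‖_∞ ≤ 1} is 4-avoidable. -/

import Mathlib

/-- Points of `ℤ^d`. -/
abbrev Pt (d : ℕ) := Fin d → ℤ

namespace RI

variable {d : ℕ}

/-- `l¹` distance between two points (ℕ-valued). -/
def n1 (x y : Pt d) : ℕ := ∑ j, (x j - y j).natAbs

/-- `l∞` distance between two points (ℕ-valued). -/
def ninf (x y : Pt d) : ℕ := Finset.univ.sup fun j => (x j - y j).natAbs

/-- nearest-neighbor adjacency: `‖x - y‖₁ = 1` -/
def adj (x y : Pt d) : Prop := n1 x y = 1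

/-- `*`-adjacency: `‖x - y‖_∞ = 1` -/
def adjStar (x y : Pt d) : Prop := ninf x y = 1

/-- `τ` is a nearest-neighbor path of length `N`. -/
def IsPath (τ : ℕ → Pt d) (N : ℕ) : Prop := ∀ l < N, adj (τ l) (τ (l + 1))

/-- the range of a path of length `N` -/
def pathRange (τ : ℕ → Pt d) (N : ℕ) : Set (Pt d) := τ '' {l | l ≤ N}

/-- `x` and `y` are joined by a nearest-neighbor path all of whose points lie in `U`. -/
def ConnIn (U : Set (Pt d)) (x y : Pt d) : Prop :=
  ∃ τ N, IsPath τ N ∧ τ 0 = x ∧ τ N = y ∧ ∀ l ≤ N, τ l ∈ U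

/-- a set is connected: any two of its points are joined by a path inside it -/
def ConnSet (A : Set (Pt d)) : Prop := ∀ x ∈ A, ∀ y ∈ A, ConnIn A x y

/-- the connected component of `U` containing `x` -/
def comp (U : Set (Pt d)) (x : Pt d) : Set (Pt d) := {y | ConnIn U x y}

/-- the (outer) boundary `∂K` -/
def bd (K : Set (Pt d)) : Set (Pt d) := {x | x ∉ K ∧ ∃ y ∈ K, adj x y}

/-- the `*`-boundary `∂*K` -/
def bdStar (K : Set (Pt d)) : Set (Pt d) := {x | x ∉ K ∧ ∃ y ∈ K, adjStar x y}

/-- the interior boundary `∂_int K` -/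
def intBd (K : Set (Pt d)) : Set (Pt d) := {x | x ∈ K ∧ ∃ y, y ∉ K ∧ adj x y}

/-- the `l∞` diameter of a set, valued in `ℕ∞` -/
noncomputable def diam (K : Set (Pt d)) : ℕ∞ := ⨆ x ∈ K, ⨆ y ∈ K, (ninf x y : ℕ∞)

/-- the `l¹` distance between `K` and `K'` exceeds `1` -/
def far1 (K K' : Set (Pt d)) : Prop := ∀ x ∈ K, ∀ y ∈ K', 1 < n1 x y

/-- the `l∞` distance between `K` and `K'` exceeds `1` -/
def farInf (K K' : Set (Pt d)) : Prop := ∀ x ∈ K, ∀ y ∈ K', 1 < ninf x y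

/-- `d_∞(K, K') ≤ r` -/
def dInfLE (K K' : Set (Pt d)) (r : ℕ) : Prop := ∃ x ∈ K, ∃ y ∈ K', ninf x y ≤ r

/-- `fill A`: the set of points every connected set around which inside `Aᶜ` is finite;
for `d ≥ 2` and finite `A` this is exactly the complement of the unique infinite
connected component of `Aᶜ`. -/
def fill (A : Set (Pt d)) : Set (Pt d) :=
  {z | ∀ S : Set (Pt d), z ∈ S → S ⊆ Aᶜ → ConnSet S → S.Finite}

/-- `A₁` and `A₂` are separated by `𝒰` in `B`: `d(A₁,A₂) > 1` and every path in `B`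
joining `∂A₁` to `∂A₂` meets `𝒰`. -/
def SeparatedBy (A₁ A₂ 𝒰 B : Set (Pt d)) : Prop :=
  far1 A₁ A₂ ∧
  ∀ τ N, IsPath τ N → (∀ l ≤ N, τ l ∈ B) → τ 0 ∈ bd A₁ → τ N ∈ bd A₂ →
    ∃ l ≤ N, τ l ∈ 𝒰

/-- the scales `L_κ = L₀ (80 L)^κ` -/
def Lscale (L L₀ κ : ℕ) : ℕ := L₀ * (80 * L) ^ κ

/-- the box `C_{(κ,i)} = (i L_κ + [0, L_κ)^d) ∩ ℤ^d` -/
def boxC (L L₀ κ : ℕ) (i : Pt d) : Set (Pt d) :=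
  {x | ∀ j, i j * (Lscale L L₀ κ : ℤ) ≤ x j ∧
    x j < i j * (Lscale L L₀ κ : ℤ) + (Lscale L L₀ κ : ℤ)}

/-- the neighborhood `C_{(κ,i)}^l = ⋃_{‖j‖_∞ < l} C_{(κ, i+j)}` -/
def boxCl (L L₀ κ : ℕ) (i : Pt d) (l : ℕ) : Set (Pt d) :=
  ⋃ j ∈ {j : Pt d | ∀ t, (j t).natAbs < l}, boxC L L₀ κ (i + j)

/-- the separation event `χ_{(κ,i)}(𝒰) = 1`: there are connected sets
`A₁, A₂ ⊆ C_{(κ,i)}^2` of diameter at least `L_κ / 2` separated by `𝒰` in `C_{(κ,i)}^3` -/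
def chi (L L₀ κ : ℕ) (i : Pt d) (𝒰 : Set (Pt d)) : Prop :=
  ∃ A₁ A₂ : Set (Pt d), A₁ ⊆ boxCl L L₀ κ i 2 ∧ A₂ ⊆ boxCl L L₀ κ i 2 ∧
    ConnSet A₁ ∧ ConnSet A₂ ∧
    (Lscale L L₀ κ : ℕ∞) ≤ 2 * diam A₁ ∧ (Lscale L L₀ κ : ℕ∞) ≤ 2 * diam A₂ ∧
    SeparatedBy A₁ A₂ 𝒰 (boxCl L L₀ κ i 3)

/-- the centered boxes `C^l = [-(l-1)L₀, l L₀)^d ∩ ℤ^d` -/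
def boxCen (L₀ l : ℕ) : Set (Pt d) :=
  {x | ∀ j, -(((l : ℤ) - 1) * (L₀ : ℤ)) ≤ x j ∧ x j < (l : ℤ) * (L₀ : ℤ)}

/-- the separation event `χ(𝒰) = 1` for the centered boxes -/
def chi0 (L₀ : ℕ) (𝒰 : Set (Pt d)) : Prop :=
  ∃ A₁ A₂ : Set (Pt d), A₁ ⊆ boxCen L₀ 2 ∧ A₂ ⊆ boxCen L₀ 2 ∧
    ConnSet A₁ ∧ ConnSet A₂ ∧
    (L₀ : ℕ∞) ≤ 2 * diam A₁ ∧ (L₀ : ℕ∞) ≤ 2 * diam A₂ ∧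
    SeparatedBy A₁ A₂ 𝒰 (boxCen L₀ 3)

/-- `A` is `h`-avoidable in `C`: every path in `C` with endpoints outside `A` can be
modified, within `l∞` distance `h` of its range and through `Range(τ) ∪ ∂*A`,
into a path with the same endpoints avoiding `A`. -/
def Avoidable (h : ℝ) (A C : Set (Pt d)) : Prop :=
  ∀ τ N, IsPath τ N → (∀ l ≤ N, τ l ∈ C) → τ 0 ∉ A → τ N ∉ A →
    ∃ τ' N', IsPath τ' N' ∧ τ' 0 = τ 0 ∧ τ' N' = τ N ∧
      (∀ l ≤ N', τ' l ∉ A) ∧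
      (∀ l ≤ N', (∃ k ≤ N, (ninf (τ' l) (τ k) : ℝ) ≤ h) ∧
        (τ' l ∈ pathRange τ N ∨ τ' l ∈ bdStar A))

/-- a doubly infinite transient nearest-neighbor trajectory -/
def IsTraj (w : ℤ → Pt d) : Prop :=
  (∀ l : ℤ, adj (w l) (w (l + 1))) ∧
  Filter.Tendsto (fun l : ℤ => n1 (w l) 0) Filter.cofinite Filter.atTop

/-- `k` is a cut-time of `w`: `d_∞({w(l) : l < k}, {w(l) : l > k}) > 1` -/
def CutTime (w : ℤ → Pt d) (k : ℤ) : Prop :=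
  ∀ l, l < k → ∀ l', k < l' → 1 < ninf (w l) (w l')

/-- the `j`-th sausage `𝒰_j = {w(l) : n_j < l < n_{j+1}}` -/
def sausage (w : ℤ → Pt d) (n : ℕ → ℤ) (j : ℕ) : Set (Pt d) :=
  w '' {l | n j < l ∧ l < n (j + 1)}

/-- boxes: products of integer intervals -/
def IsBox (B : Set (Pt d)) : Prop :=
  ∃ a b : Pt d, B = {x | ∀ j, a j ≤ x j ∧ x j ≤ b j}

/-- the smallest box containing `K` -/
def sbox (K : Set (Pt d)) : Set (Pt d) := ⋂₀ {B | IsBox B ∧ K ⊆ B}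

/-- the closed `l∞` ball `B(x, r)` -/
def ball (x : Pt d) (r : ℕ) : Set (Pt d) := {y | ninf x y ≤ r}

/-- a skeleton: a set of indices at the finest scale satisfying the Wiener-type
spacing conditions -/
def IsSkeleton (L L₀ : ℕ) (M : Finset (Pt d)) : Prop :=
  ∀ m₀ ∈ M,
    (∀ h : ℕ,
      {m : Pt d | m ∈ M ∧
        dInfLE (boxC L L₀ 0 m₀) (boxC L L₀ 0 m) (L * Lscale L L₀ (h + 1)) ∧
        ¬ dInfLE (boxC L L₀ 0 m₀) (boxC L L₀ 0 m) (L * Lscale L L₀ h)}.ncard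
        ≤ 2 ^ (h + 1)) ∧
    ∀ m ∈ M, m ≠ m₀ → ¬ dInfLE (boxC L L₀ 0 m₀) (boxC L L₀ 0 m) (L * Lscale L L₀ 0)

theorem ninf_le_iff {x y : Pt d} {r : ℕ} : ninf x y ≤ r ↔ ∀ j, (x j - y j).natAbs ≤ r := by
  simp [ninf]

theorem natAbs_sub_le_ninf (x y : Pt d) (j : Fin d) : (x j - y j).natAbs ≤ ninf x y :=
  ninf_le_iff.1 le_rfl j

theorem ninf_zero_le_iff {x : Pt d} {r : ℕ} : ninf x 0 ≤ r ↔ ∀ j, (x j).natAbs ≤ r := by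
  simp [ninf]

theorem natAbs_sub_le_one_of_adj {x y : Pt d} (h : adj x y) (j : Fin d) :
    (x j - y j).natAbs ≤ 1 := by
  rw [← show n1 x y = 1 from h]
  exact Finset.single_le_sum (f := fun j => (x j - y j).natAbs) (fun _ _ => Nat.zero_le _)
    (Finset.mem_univ j)

theorem adj_symm {x y : Pt d} (h : adj x y) : adj y x := by
  have h' : n1 x y = 1 := h
  unfold adj n1
  rw [← h']
  exact Finset.sum_congr rfl fun j _ => by omega

theorem adj_update_add_one (x : Pt d) (j : Fin d) :
    adj x (Function.update x j (x j + 1)) := by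
  unfold adj n1
  rw [Finset.sum_eq_single j]
  · simp
  · intro k _ hk
    simp [hk]
  · simp

/-- Adjacency of two points inside `U`. -/
def AdjIn (U : Set (Pt d)) (x y : Pt d) : Prop := adj x y ∧ x ∈ U ∧ y ∈ U

theorem symmetric_reflTransGen_adjIn (U : Set (Pt d)) {x y : Pt d}
    (h : Relation.ReflTransGen (AdjIn U) x y) : Relation.ReflTransGen (AdjIn U) y x := by
  induction h with
  | refl => exact .refl
  | tail _ h ih => exact .head ⟨adj_symm h.1, h.2.2, h.2.1⟩ ih

theorem connIn_of_reflTransGen {U : Set (Pt d)} {x y : Pt d} (hx : x ∈ U)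
    (h : Relation.ReflTransGen (AdjIn U) x y) : ConnIn U x y := by
  induction h with
  | refl => exact ⟨fun _ => x, 0, fun l hl => absurd hl (Nat.not_lt_zero l), rfl, rfl, fun _ _ => hx⟩
  | @tail b c _ hbc ih =>
    obtain ⟨τ, N, hτ, h0, hN, hU⟩ := ih
    refine ⟨fun l => if l ≤ N then τ l else c, N + 1, fun l hl => ?_, by simp [h0], by simp,
      fun l _ => ?_⟩
    · rcases Nat.lt_or_eq_of_le (Nat.le_of_lt_succ hl) with hl | rfl
      · simpa [hl.le, Nat.succ_le_of_lt hl] using hτ l hl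
      · simpa [hN] using hbc.1
    · dsimp only
      split_ifs with hl
      · exact hU l hl
      · exact hbc.2.2

/-- The `l∞` sphere of radius `r` about the origin. -/
def sphere (d r : ℕ) : Set (Pt d) := {x | (∀ j, (x j).natAbs ≤ r) ∧ ∃ i, (x i).natAbs = r}

theorem reflTransGen_update {r : ℕ} {x : Pt d} {i j : Fin d} (hij : i ≠ j)
    (hx : ∀ k, (x k).natAbs ≤ r) (hi : (x i).natAbs = r) :
    Relation.ReflTransGen (AdjIn (sphere d r)) x (Function.update x j (r : ℤ)) := by
  obtain ⟨n, hn⟩ : ∃ n : ℕ, (r : ℤ) - x j = n :=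
    ⟨((r : ℤ) - x j).toNat, by have := hx j; omega⟩
  induction n generalizing x with
  | zero =>
    have : (r : ℤ) = x j := by push_cast at hn; omega
    rw [this, Function.update_eq_self]
  | succ n ih =>
    have hx' : ∀ k, (Function.update x j (x j + 1) k).natAbs ≤ r := by
      intro k
      have := hx k
      by_cases hk : k = j
      · subst hk
        rw [Function.update_self]
        omega
      · simpa [hk] using this
    have hi' : (Function.update x j (x j + 1) i).natAbs = r := by simpa [hij] using hi
    have := ih hx' hi' (by simp; push_cast at hn; omega)
    rw [Function.update_idem] at this
    exact .head ⟨adj_update_add_one x j, ⟨hx, i, hi⟩, ⟨hx', i, hi'⟩⟩ this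

theorem reflTransGen_piecewise {r : ℕ} {x : Pt d} {i : Fin d}
    (hx : ∀ k, (x k).natAbs ≤ r) (hi : x i = r) (s : Finset (Fin d)) :
    Relation.ReflTransGen (AdjIn (sphere d r)) x (fun k => if k ∈ s then (r : ℤ) else x k) := by
  induction s using Finset.induction_on with
  | empty => simpa using Relation.ReflTransGen.refl
  | insert a s _ ih =>
    have hupd : (fun k => if k ∈ insert a s then (r : ℤ) else x k) =
        Function.update (fun k => if k ∈ s then (r : ℤ) else x k) a (r : ℤ) := by
      funext k
      by_cases hk : k = a
      · subst hk; simp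
      · simp [hk]
    rw [hupd]
    by_cases hia : i = a
    · subst hia
      rwa [Function.update_eq_self_iff.2 (by simp [hi])]
    · refine ih.trans (reflTransGen_update hia (fun k => ?_) (by simp [hi]))
      split_ifs
      · simp
      · exact hx k

theorem reflTransGen_sphere (hd : 2 ≤ d) {r : ℕ} {x y : Pt d} (hx : x ∈ sphere d r)
    (hy : y ∈ sphere d r) : Relation.ReflTransGen (AdjIn (sphere d r)) x y := by
  have corner : ∀ z ∈ sphere d r,
      Relation.ReflTransGen (AdjIn (sphere d r)) z (fun _ => (r : ℤ)) := by
    rintro z ⟨hz, i, hi⟩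
    have : Nontrivial (Fin d) := Fin.nontrivial_iff_two_le.2 hd
    obtain ⟨j, hj⟩ := exists_ne i
    have hz' : ∀ k, (Function.update z j (r : ℤ) k).natAbs ≤ r := by
      intro k
      by_cases hk : k = j
      · subst hk; simp
      · simpa [hk] using hz k
    refine (reflTransGen_update hj.symm hz hi).trans ?_
    simpa using reflTransGen_piecewise (i := j) hz' (by simp) Finset.univ
  exact (corner x hx).trans (symmetric_reflTransGen_adjIn _ (corner y hy))

theorem mem_sphere_of_adj {r : ℕ} {x y : Pt d} (hx : ¬ ninf x 0 ≤ r) (hy : ninf y 0 ≤ r)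
    (h : adj x y) : x ∈ sphere d (r + 1) := by
  rw [ninf_zero_le_iff] at hx hy
  have hle : ∀ j, (x j).natAbs ≤ r + 1 := fun j => by
    have := natAbs_sub_le_one_of_adj h j
    have := hy j
    omega
  push Not at hx
  obtain ⟨i, hi⟩ := hx
  exact ⟨hle, i, le_antisymm (hle i) hi⟩

theorem not_ninf_le_of_mem_sphere {r : ℕ} {x : Pt d} (hx : x ∈ sphere d (r + 1)) :
    ¬ ninf x 0 ≤ r := by
  rw [ninf_zero_le_iff]
  obtain ⟨-, i, hi⟩ := hx
  intro h
  have := h i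
  omega

theorem sphere_subset_bdStar (r : ℕ) :
    sphere d (r + 1) ⊆ bdStar {x : Pt d | ninf x 0 ≤ r} := by
  intro x hx
  refine ⟨not_ninf_le_of_mem_sphere hx, fun j => max (-(r : ℤ)) (min r (x j)), ?_, ?_⟩
  · exact ninf_zero_le_iff.2 fun j => by omega
  · obtain ⟨hle, i, hi⟩ := hx
    refine le_antisymm (ninf_le_iff.2 fun j => ?_)
      (le_trans ?_ (natAbs_sub_le_ninf _ _ i))
    · have := hle j
      omega
    · omega

/-- Excursions of a path into a ball can be rerouted along the surrounding sphere. -/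
theorem reflTransGen_reroute (hd : 2 ≤ d) {r : ℕ} {τ : ℕ → Pt d} {N : ℕ} (hτ : IsPath τ N)
    (h0 : ¬ ninf (τ 0) 0 ≤ r) (l : ℕ) (hl : l ≤ N) :
    let U := {x : Pt d | (x ∈ pathRange τ N ∧ ¬ ninf x 0 ≤ r) ∨ x ∈ sphere d (r + 1)}
    (¬ ninf (τ l) 0 ≤ r → Relation.ReflTransGen (AdjIn U) (τ 0) (τ l)) ∧
      (ninf (τ l) 0 ≤ r →
        ∀ s ∈ sphere d (r + 1), Relation.ReflTransGen (AdjIn U) (τ 0) s) := by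
  intro U
  have hS : ∀ x ∈ sphere d (r + 1), ∀ y ∈ sphere d (r + 1),
      Relation.ReflTransGen (AdjIn U) x y := fun x hx y hy =>
    Relation.ReflTransGen.mono (fun _ _ h => ⟨h.1, Or.inr h.2.1, Or.inr h.2.2⟩) _ _
      (reflTransGen_sphere hd hx hy)
  induction l with
  | zero => exact ⟨fun _ => .refl, fun h => absurd h h0⟩
  | succ l ih =>
    obtain ⟨hout, hin⟩ := ih (by omega)
    have hadj := hτ l (by omega)
    by_cases hcur : ninf (τ l) 0 ≤ r
    · exact ⟨fun h => hin hcur _ (mem_sphere_of_adj h hcur (adj_symm hadj)), fun _ => hin hcur⟩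
    · refine ⟨fun h => (hout hcur).tail ⟨hadj, Or.inl ⟨⟨l, ?_, rfl⟩, hcur⟩,
        Or.inl ⟨⟨l + 1, hl, rfl⟩, h⟩⟩, fun h s hs => (hout hcur).trans
          (hS _ (mem_sphere_of_adj hcur h hadj) s hs)⟩
      exact show l ≤ N by omega

/-- the ball `B(0,1) = {x : ‖x‖_∞ ≤ 1}` is `4`-avoidable (`d ≥ 2`). -/
theorem statement18 (d : ℕ) (hd : 2 ≤ d) :
    Avoidable 4 {x : Pt d | ninf x 0 ≤ 1} Set.univ := by
  intro τ N hτ _ h0 hN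
  by_cases hmeet : ∃ k ≤ N, ninf (τ k) 0 ≤ 1
  · obtain ⟨k, hk, hkA⟩ := hmeet
    obtain ⟨τ', N', hτ', h0', hN', hU⟩ := connIn_of_reflTransGen
      (Or.inl ⟨⟨0, Nat.zero_le N, rfl⟩, h0⟩) ((reflTransGen_reroute hd hτ h0 N le_rfl).1 hN)
    refine ⟨τ', N', hτ', h0', hN', fun l hl => ?_, fun l hl => ?_⟩
    · rcases hU l hl with h | h
      · exact h.2
      · exact not_ninf_le_of_mem_sphere h
    · rcases hU l hl with ⟨⟨m, hm, hml⟩, -⟩ | h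
      · exact ⟨⟨m, hm, by simp [← hml, ninf]⟩, Or.inl ⟨m, hm, hml⟩⟩
      · refine ⟨⟨k, hk, ?_⟩, Or.inr (sphere_subset_bdStar 1 h)⟩
        have : ninf (τ' l) (τ k) ≤ 4 := ninf_le_iff.2 fun j => by
          have := h.1 j
          have := ninf_zero_le_iff.1 hkA j
          omega
        exact_mod_cast this
  · push Not at hmeet
    exact ⟨τ, N, hτ, rfl, rfl, fun l hl h => absurd h (not_le.2 (hmeet l hl)),
      fun l hl => ⟨⟨l, hl, by simp [ninf]⟩, Or.inl ⟨l, hl, rfl⟩⟩⟩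

end RI
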